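/- arXiv:1412.1763 — 2 statements merged into one kernel-verified Lean document; each statement's English description precedes it below -/
import Mathlib

section
/- Let n ≥ 1, let H be a symmetric real n×n matrix, let a, x ∈ ℝⁿ, and let m > 0 be such that ‖(1−c)a + cx‖₂ ≥ m for every c ∈ [0,1]. Then |xᵀHx/(xᵀx) − aᵀHa/(aᵀa)| ≤ 4‖H‖·‖x − a‖₂ / m. -/
open scoped RealInnerProductSpace

section

variable {E : Type*} [NormedAddCommGroup E] [InnerProductSpace ℝ E]

/-- Normalization to the unit sphere is `2 / ‖x‖`-Lipschitz at `x`. -/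
theorem norm_inv_norm_smul_sub_le {x a : E} (hx : x ≠ 0) (ha : a ≠ 0) :
    ‖‖x‖⁻¹ • x - ‖a‖⁻¹ • a‖ ≤ 2 * ‖x - a‖ / ‖x‖ := by
  have hx' : 0 < ‖x‖ := norm_pos_iff.mpr hx
  have ha' : 0 < ‖a‖ := norm_pos_iff.mpr ha
  have hdecomp : ‖x‖⁻¹ • x - ‖a‖⁻¹ • a
      = ‖x‖⁻¹ • ((x - a) + (‖a‖ - ‖x‖) • (‖a‖⁻¹ • a)) := by
    match_scalars <;> field_simp
    ring
  have hunit : ‖‖a‖⁻¹ • a‖ = 1 := by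
    rw [norm_smul, norm_inv, norm_norm, inv_mul_cancel₀ ha'.ne']
  have hsum : ‖(x - a) + (‖a‖ - ‖x‖) • (‖a‖⁻¹ • a)‖ ≤ 2 * ‖x - a‖ := by
    refine (norm_add_le _ _).trans ?_
    rw [norm_smul, hunit, mul_one, Real.norm_eq_abs, two_mul, norm_sub_rev x a]
    gcongr
    exact abs_norm_sub_norm_le a x
  rw [hdecomp, norm_smul, norm_inv, norm_norm, inv_mul_eq_div]
  gcongr

/-- On the unit sphere the quadratic form of `T` is `2‖T‖`-Lipschitz. -/
theorem abs_inner_apply_sub_inner_apply_le (T : E →L[ℝ] E) {u v : E}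
    (hu : ‖u‖ = 1) (hv : ‖v‖ = 1) :
    |⟪u, T u⟫ - ⟪v, T v⟫| ≤ 2 * ‖T‖ * ‖u - v‖ := by
  have hdecomp : ⟪u, T u⟫ - ⟪v, T v⟫ = ⟪u - v, T u⟫ + ⟪v, T (u - v)⟫ := by
    rw [map_sub, inner_sub_left, inner_sub_right]
    ring
  have h₁ : |⟪u - v, T u⟫| ≤ ‖u - v‖ * ‖T‖ :=
    (abs_real_inner_le_norm _ _).trans
      (mul_le_mul_of_nonneg_left (by simpa [hu] using T.le_opNorm u) (norm_nonneg _))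
  have h₂ : |⟪v, T (u - v)⟫| ≤ ‖T‖ * ‖u - v‖ :=
    (abs_real_inner_le_norm _ _).trans (by simpa [hv] using T.le_opNorm (u - v))
  rw [hdecomp]
  linarith [abs_add_le ⟪u - v, T u⟫ ⟪v, T (u - v)⟫]

theorem inner_apply_div_inner_self (T : E →L[ℝ] E) (y : E) :
    ⟪y, T y⟫ / ⟪y, y⟫ = ⟪‖y‖⁻¹ • y, T (‖y‖⁻¹ • y)⟫ := by
  rw [map_smul, real_inner_smul_left, real_inner_smul_right, real_inner_self_eq_norm_sq]
  ring

/-- The Rayleigh quotient of `T` is `4‖T‖ / ‖x‖`-Lipschitz at `x`. -/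
theorem abs_rayleigh_sub_rayleigh_le (T : E →L[ℝ] E) {x a : E} (hx : x ≠ 0) (ha : a ≠ 0) :
    |⟪x, T x⟫ / ⟪x, x⟫ - ⟪a, T a⟫ / ⟪a, a⟫| ≤ 4 * ‖T‖ * ‖x - a‖ / ‖x‖ := by
  have hunit {y : E} (hy : y ≠ 0) : ‖‖y‖⁻¹ • y‖ = 1 := by
    rw [norm_smul, norm_inv, norm_norm, inv_mul_cancel₀ (norm_ne_zero_iff.mpr hy)]
  rw [inner_apply_div_inner_self, inner_apply_div_inner_self]
  calc |⟪‖x‖⁻¹ • x, T (‖x‖⁻¹ • x)⟫ - ⟪‖a‖⁻¹ • a, T (‖a‖⁻¹ • a)⟫|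
      ≤ 2 * ‖T‖ * ‖‖x‖⁻¹ • x - ‖a‖⁻¹ • a‖ :=
        abs_inner_apply_sub_inner_apply_le T (hunit hx) (hunit ha)
    _ ≤ 2 * ‖T‖ * (2 * ‖x - a‖ / ‖x‖) := by
        gcongr
        exact norm_inv_norm_smul_sub_le hx ha
    _ = 4 * ‖T‖ * ‖x - a‖ / ‖x‖ := by ring

end

/-- if the segment from `a` to `x` stays at Euclidean distance at least
`m > 0` from the origin, then the Rayleigh quotients of the symmetric matrix `H` at
`x` and `a` differ by at most `4‖H‖·‖x − a‖₂/m`. -/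
theorem rayleigh_lipschitz_on_segment (n : ℕ) (hn : 1 ≤ n)
    (H : Matrix (Fin n) (Fin n) ℝ) (hH : H.IsSymm)
    (a x : EuclideanSpace ℝ (Fin n)) (m : ℝ) (hm : 0 < m)
    (hseg : ∀ c ∈ Set.Icc (0 : ℝ) 1, m ≤ ‖(1 - c) • a + c • x‖) :
    |⟪x, Matrix.toEuclideanLin H x⟫ / ⟪x, x⟫
      - ⟪a, Matrix.toEuclideanLin H a⟫ / ⟪a, a⟫|
      ≤ 4 * ‖Matrix.toEuclideanCLM (𝕜 := ℝ) H‖ * ‖x - a‖ / m := by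
  have hma : m ≤ ‖a‖ := by simpa using hseg 0 (by simp)
  have hmx : m ≤ ‖x‖ := by simpa using hseg 1 (by simp)
  have ha : a ≠ 0 := norm_pos_iff.mp (hm.trans_le hma)
  have hx : x ≠ 0 := norm_pos_iff.mp (hm.trans_le hmx)
  refine (abs_rayleigh_sub_rayleigh_le (Matrix.toEuclideanCLM (𝕜 := ℝ) H) hx ha).trans ?_
  gcongr
end

section
/- (Distance Lemma, deterministic form.) Let T₀ ⊆ {1,…,n} be nonempty with |T₀| = F₀, let H be a symmetric real n×n matrix with ‖H‖ ≤ F₀, and let a, x ∈ ℝⁿ be vectors whose coordinates vanish outside T₀, with a ≠ 0 and such that ‖(1−c)a + cx‖₂ ≥ ‖a‖₂ for all c ∈ [0,1]. Write F(y) = (yᵀHy)/(yᵀy). Let 0 < ε < 1. If |F(a) − 1| ≤ ε/2 and F(x) ∈ {1−ε, 1+ε}, then ‖x − a‖₁ ≥ ε·‖a‖₁ / (8·F₀^{3/2}). -/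
open scoped RealInnerProductSpace

/-- The Rayleigh quotient of a bounded operator `T` satisfies
`|F x - F a| ≤ 4 ‖T‖ ‖x - a‖ / ‖a‖` whenever `‖a‖ ≤ ‖x‖`. -/
theorem abs_rayleigh_sub_rayleigh_mul_norm_le {E : Type*} [NormedAddCommGroup E]
    [InnerProductSpace ℝ E] (T : E →L[ℝ] E) {a x : E} (ha : a ≠ 0) (hax : ‖a‖ ≤ ‖x‖) :
    |⟪x, T x⟫ / ⟪x, x⟫ - ⟪a, T a⟫ / ⟪a, a⟫| * ‖a‖ ≤ 4 * ‖T‖ * ‖x - a‖ := by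
  have hapos : 0 < ‖a‖ := norm_pos_iff.mpr ha
  have hxpos : 0 < ‖x‖ := hapos.trans_le hax
  have inner_le (u v : E) : |⟪u, T v⟫| ≤ ‖T‖ * (‖u‖ * ‖v‖) :=
    calc |⟪u, T v⟫| ≤ ‖u‖ * ‖T v‖ := abs_real_inner_le_norm u (T v)
      _ ≤ ‖u‖ * (‖T‖ * ‖v‖) := by gcongr; exact T.le_opNorm v
      _ = ‖T‖ * (‖u‖ * ‖v‖) := by ring
  set t := ⟪a, T a⟫ / ⟪a, a⟫ with ht
  have haa : ⟪a, T a⟫ = t * ⟪a, a⟫ := by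
    rw [ht, div_mul_cancel₀ _ (inner_self_ne_zero.mpr ha)]
  have htT : |t| ≤ ‖T‖ := by
    rw [ht, real_inner_self_eq_norm_mul_norm, abs_div, abs_of_pos (mul_pos hapos hapos),
      div_le_iff₀ (mul_pos hapos hapos)]
    exact inner_le a a
  have t_inner_le (u v : E) : |t * ⟪u, v⟫| ≤ ‖T‖ * (‖u‖ * ‖v‖) := by
    rw [abs_mul]
    exact mul_le_mul htT (abs_real_inner_le_norm u v) (abs_nonneg _) (norm_nonneg _)
  have hsplit : ⟪x, T x⟫ - t * ⟪x, x⟫ =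
      ⟪x - a, T x⟫ + ⟪a, T (x - a)⟫ - t * ⟪x - a, x⟫ - t * ⟪a, x - a⟫ := by
    simp only [map_sub, inner_sub_left, inner_sub_right]
    linear_combination haa
  have hnum : |⟪x, T x⟫ - t * ⟪x, x⟫| ≤ 4 * ‖T‖ * ‖x - a‖ * ‖x‖ := by
    have h₁ := abs_le.mp (inner_le (x - a) x)
    have h₂ := abs_le.mp (inner_le a (x - a))
    have h₃ := abs_le.mp (t_inner_le (x - a) x)
    have h₄ := abs_le.mp (t_inner_le a (x - a))
    have h₅ : ‖T‖ * (‖a‖ * ‖x - a‖) ≤ ‖T‖ * (‖x - a‖ * ‖x‖) := by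
      rw [mul_comm ‖a‖]; gcongr
    rw [hsplit, abs_le]
    constructor <;> linarith [h₁.1, h₁.2, h₂.1, h₂.2, h₃.1, h₃.2, h₄.1, h₄.2]
  have hxx : ⟪x, T x⟫ / ⟪x, x⟫ - t = (⟪x, T x⟫ - t * ⟪x, x⟫) / (‖x‖ * ‖x‖) := by
    rw [real_inner_self_eq_norm_mul_norm]
    field_simp
  rw [hxx, abs_div, abs_of_pos (mul_pos hxpos hxpos)]
  calc _ ≤ 4 * ‖T‖ * ‖x - a‖ * ‖x‖ / (‖x‖ * ‖x‖) * ‖x‖ := by gcongr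
    _ = 4 * ‖T‖ * ‖x - a‖ := by field_simp

theorem EuclideanSpace.norm_le_sum_abs {ι : Type*} [Fintype ι] (v : EuclideanSpace ℝ ι) :
    ‖v‖ ≤ ∑ i, |v i| := by
  rw [EuclideanSpace.norm_eq]
  refine Real.sqrt_le_iff.mpr ⟨Finset.sum_nonneg fun i _ => abs_nonneg _, ?_⟩
  exact Finset.sum_sq_le_sq_sum_of_nonneg fun i _ => abs_nonneg _

theorem EuclideanSpace.sum_abs_le_sqrt_card_mul_norm {ι : Type*} [Fintype ι] {s : Finset ι}
    {v : EuclideanSpace ℝ ι} (hv : ∀ i ∉ s, v i = 0) :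
    ∑ i, |v i| ≤ √(s.card : ℝ) * ‖v‖ := by
  have hsum : ∑ i ∈ s, |v i| = ∑ i, |v i| :=
    Finset.sum_subset s.subset_univ fun i _ hi => by simp [hv i hi]
  rw [EuclideanSpace.norm_eq, ← Real.sqrt_mul (Nat.cast_nonneg _), ← hsum]
  refine Real.le_sqrt_of_sq_le (sq_sum_le_card_mul_sum_sq.trans ?_)
  gcongr
  exact Finset.sum_le_sum_of_subset_of_nonneg s.subset_univ fun i _ _ => sq_nonneg _

/-- Distance Lemma, deterministic form: if the Rayleigh quotient
`F(y) = yᵀHy/yᵀy` of a symmetric `H` with `‖H‖ ≤ F₀` satisfies `|F(a) − 1| ≤ ε/2`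
and `F(x) ∈ {1−ε, 1+ε}`, where `a, x` are supported in `T₀` (of size `F₀`), `a ≠ 0`,
and the segment from `a` to `x` stays at norm `≥ ‖a‖₂`, then
`‖x − a‖₁ ≥ ε‖a‖₁/(8·F₀^{3/2})`. -/
theorem distance_lemma (n : ℕ) (T₀ : Finset (Fin n)) (hT₀ : T₀.Nonempty)
    (F₀ : ℕ) (hF₀ : F₀ = T₀.card)
    (H : Matrix (Fin n) (Fin n) ℝ) (hsymm : H.IsSymm)
    (hnorm : ‖Matrix.toEuclideanCLM (𝕜 := ℝ) H‖ ≤ (F₀ : ℝ))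
    (a x : EuclideanSpace ℝ (Fin n))
    (ha0 : ∀ i ∉ T₀, a i = 0) (hx0 : ∀ i ∉ T₀, x i = 0)
    (hane : a ≠ 0)
    (hseg : ∀ c ∈ Set.Icc (0 : ℝ) 1, ‖a‖ ≤ ‖(1 - c) • a + c • x‖)
    (ε : ℝ) (hε0 : 0 < ε) (hε1 : ε < 1)
    (F : EuclideanSpace ℝ (Fin n) → ℝ)
    (hF : ∀ y, F y = ⟪y, Matrix.toEuclideanLin H y⟫ / ⟪y, y⟫)
    (haF : |F a - 1| ≤ ε / 2)
    (hxF : F x = 1 - ε ∨ F x = 1 + ε) :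
    ε * (∑ i, |a i|) / (8 * (F₀ : ℝ) ^ ((3 : ℝ) / 2)) ≤ ∑ i, |x i - a i| := by
  have hax : ‖a‖ ≤ ‖x‖ := by simpa using hseg 1 (by simp)
  have hlip : |F x - F a| * ‖a‖ ≤ 4 * ‖Matrix.toEuclideanCLM (𝕜 := ℝ) H‖ * ‖x - a‖ := by
    rw [hF, hF]
    exact abs_rayleigh_sub_rayleigh_mul_norm_le (Matrix.toEuclideanCLM (𝕜 := ℝ) H) hane hax
  have hgap : ε / 2 ≤ |F x - F a| := by
    obtain ⟨h₁, h₂⟩ := abs_le.mp haF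
    rcases hxF with h | h <;> rw [le_abs, h]
    · right; linarith
    · left; linarith
  have hdist : ε * ‖a‖ ≤ 8 * F₀ * ‖x - a‖ := by
    have h₁ : ε / 2 * ‖a‖ ≤ |F x - F a| * ‖a‖ := by gcongr
    have h₂ : 4 * ‖Matrix.toEuclideanCLM (𝕜 := ℝ) H‖ * ‖x - a‖ ≤ 4 * F₀ * ‖x - a‖ := by gcongr
    linarith
  have hpos : (0 : ℝ) < F₀ := by
    rw [hF₀]
    exact_mod_cast hT₀.card_pos
  have hpow : (F₀ : ℝ) ^ ((3 : ℝ) / 2) = F₀ * √F₀ := by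
    rw [Real.sqrt_eq_rpow, ← Real.rpow_one_add' hpos.le (by norm_num)]
    norm_num
  have ha₁ : ∑ i, |a i| ≤ √F₀ * ‖a‖ := by
    rw [hF₀]
    exact EuclideanSpace.sum_abs_le_sqrt_card_mul_norm ha0
  have hd₁ : ‖x - a‖ ≤ ∑ i, |x i - a i| := EuclideanSpace.norm_le_sum_abs (x - a)
  rw [hpow, div_le_iff₀ (by positivity)]
  calc ε * ∑ i, |a i| ≤ ε * (√F₀ * ‖a‖) := by gcongr
    _ = √F₀ * (ε * ‖a‖) := by ring
    _ ≤ √F₀ * (8 * F₀ * ‖x - a‖) := by gcongr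
    _ ≤ √F₀ * (8 * F₀ * ∑ i, |x i - a i|) := by gcongr
    _ = (∑ i, |x i - a i|) * (8 * (F₀ * √F₀)) := by ring
end
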